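/- Let λ, r₂, t₁, t₂, t₃ be real numbers with |t₁| ≥ |t₂| ≥ |t₃|, and let M be the real 3×4 matrix whose 0-th column is (0, r₂(1−λ), 0)ᵀ and whose remaining 3×3 block is (λ/2)·diag(t₁, t₂, t₃), all scaled so that M = (1/2)·[(0, r₂(1−λ), 0)ᵀ | λ·diag(t₁,t₂,t₃)]. Then the minimum of ‖M − P·M‖₂² over all real 3×3 orthogonal projection matrices P of rank 1 equals (1/4)·[λ²t₃² + min{λ²t₁², λ²t₂² + r₂²(1−λ)²}]. -/

import Mathlib

open Matrix

/-- The `B`-correlation matrix `𝒯^B` of `ρ = λ ρ_BD + (1-λ) ρ_p` with `r₁ = r₃ = 0`: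
first column `(0, r₂(1-λ), 0)ᵀ`, remaining block `λ·diag(t₁,t₂,t₃)`, all times `1/2`. -/
noncomputable def corrMatB' (l r₂ t₁ t₂ t₃ : ℝ) : Matrix (Fin 3) (Fin 4) ℝ :=
  (1 / 2 : ℝ) • !![0, l * t₁, 0, 0;
                   r₂ * (1 - l), 0, l * t₂, 0;
                   0, 0, 0, l * t₃]

theorem Matrix.trace_eq_rank_of_isIdempotentElem {n K : Type*} [Fintype n] [Field K]
    {P : Matrix n n K} (hP : IsIdempotentElem P) : P.trace = P.rank := by
  classical
  have hlin : IsIdempotentElem (toLin' P) := hP.map (toLinAlgEquiv' (R := K) (n := n))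
  rw [← trace_toLin'_eq, (LinearMap.IsIdempotentElem.isProj_range _ hlin).trace,
    Matrix.rank, ← toLin'_apply']

theorem Matrix.diag_nonneg_of_transpose_eq_of_isIdempotentElem {n : Type*} [Fintype n]
    {P : Matrix n n ℝ} (hT : Pᵀ = P) (hP : IsIdempotentElem P) (i : n) : 0 ≤ P i i := by
  have h : (P * Pᵀ) i i = P i i := by rw [hT, hP.eq]
  rw [← h, mul_apply]
  exact Finset.sum_nonneg fun j _ => mul_self_nonneg (P i j)

/-- The squared Frobenius norm of `M - P * M` is `Tr((1 - P) M Mᵀ)`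
for an orthogonal projection `P`. -/
theorem Matrix.trace_sub_mul_mul_transpose {m n R : Type*} [Fintype m] [DecidableEq m]
    [Fintype n] [CommRing R] {P : Matrix m m R} (hT : Pᵀ = P) (hP : IsIdempotentElem P)
    (M : Matrix m n R) :
    ((M - P * M) * (M - P * M)ᵀ).trace = ((1 - P) * (M * Mᵀ)).trace := by
  have hM : M - P * M = (1 - P) * M := by rw [Matrix.sub_mul, Matrix.one_mul]
  rw [hM, transpose_mul, transpose_sub, transpose_one, hT, ← Matrix.mul_assoc, trace_mul_comm,
    ← Matrix.mul_assoc, ← Matrix.mul_assoc, hP.one_sub.eq, Matrix.mul_assoc]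

theorem corrMatB'_mul_transpose (l r₂ t₁ t₂ t₃ : ℝ) :
    corrMatB' l r₂ t₁ t₂ t₃ * (corrMatB' l r₂ t₁ t₂ t₃)ᵀ =
      diagonal ![l ^ 2 * t₁ ^ 2 / 4, (l ^ 2 * t₂ ^ 2 + r₂ ^ 2 * (1 - l) ^ 2) / 4,
        l ^ 2 * t₃ ^ 2 / 4] := by
  ext i j
  fin_cases i <;> fin_cases j <;>
    simp [corrMatB', mul_apply, Fin.sum_univ_four] <;> ring

theorem trace_corrMatB'_sub_mul {P : Matrix (Fin 3) (Fin 3) ℝ} (hT : Pᵀ = P)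
    (hP : IsIdempotentElem P) (l r₂ t₁ t₂ t₃ : ℝ) :
    ((corrMatB' l r₂ t₁ t₂ t₃ - P * corrMatB' l r₂ t₁ t₂ t₃) *
        (corrMatB' l r₂ t₁ t₂ t₃ - P * corrMatB' l r₂ t₁ t₂ t₃)ᵀ).trace =
      1 / 4 * ((1 - P 0 0) * (l ^ 2 * t₁ ^ 2) +
        (1 - P 1 1) * (l ^ 2 * t₂ ^ 2 + r₂ ^ 2 * (1 - l) ^ 2) +
        (1 - P 2 2) * (l ^ 2 * t₃ ^ 2)) := by
  rw [trace_sub_mul_mul_transpose hT hP, corrMatB'_mul_transpose, trace]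
  simp [mul_diagonal, Fin.sum_univ_three]
  ring

theorem Matrix.rank_diagonal_single_one {n K : Type*} [Fintype n] [DecidableEq n] [Field K]
    (i : n) : (diagonal (Pi.single i (1 : K))).rank = 1 := by
  classical
  rw [rank_diagonal, Fintype.card_eq_one_iff]
  refine ⟨⟨i, by simp⟩, fun j => Subtype.ext ?_⟩
  by_contra h
  exact j.2 (Pi.single_eq_of_ne h 1)

/-- For `|t₁| ≥ |t₂| ≥ |t₃|`, the minimum of `‖M - P * M‖₂²` over rank-1 orthogonal
projections `P`, with `M = corrMatB' l r₂ t₁ t₂ t₃`, equals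
`(1/4)[λ²t₃² + min{λ²t₁², λ²t₂² + r₂²(1-λ)²}]`. -/
theorem qba_bell_diagonal_mixture (l r₂ t₁ t₂ t₃ : ℝ)
    (h12 : |t₂| ≤ |t₁|) (h23 : |t₃| ≤ |t₂|) :
    IsLeast {x : ℝ | ∃ P : Matrix (Fin 3) (Fin 3) ℝ, Pᵀ = P ∧ P * P = P ∧ P.rank = 1 ∧
        x = ((corrMatB' l r₂ t₁ t₂ t₃ - P * corrMatB' l r₂ t₁ t₂ t₃) *
              (corrMatB' l r₂ t₁ t₂ t₃ - P * corrMatB' l r₂ t₁ t₂ t₃)ᵀ).trace}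
      (1 / 4 * (l ^ 2 * t₃ ^ 2 +
        min (l ^ 2 * t₁ ^ 2) (l ^ 2 * t₂ ^ 2 + r₂ ^ 2 * (1 - l) ^ 2))) := by
  have hsq {x y : ℝ} (h : |x| ≤ |y|) : l ^ 2 * x ^ 2 ≤ l ^ 2 * y ^ 2 :=
    mul_le_mul_of_nonneg_left (sq_le_sq.mpr h) (sq_nonneg l)
  have h₁ := hsq h12
  have h₂ := hsq h23
  constructor
  · have hmem (i : Fin 3) : IsIdempotentElem (diagonal (Pi.single i (1 : ℝ))) := by
      rw [IsIdempotentElem, diagonal_mul_diagonal]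
      congr 1
      ext j
      simp [Pi.single_apply]
    rcases le_total (l ^ 2 * t₁ ^ 2) (l ^ 2 * t₂ ^ 2 + r₂ ^ 2 * (1 - l) ^ 2) with h | h
    · refine ⟨_, diagonal_transpose _, hmem 1, rank_diagonal_single_one 1, ?_⟩
      rw [trace_corrMatB'_sub_mul (diagonal_transpose _) (hmem 1), min_eq_left h]
      simp
      ring
    · refine ⟨_, diagonal_transpose _, hmem 0, rank_diagonal_single_one 0, ?_⟩
      rw [trace_corrMatB'_sub_mul (diagonal_transpose _) (hmem 0), min_eq_right h]
      simp
      ring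
  · rintro x ⟨P, hT, hP, hrank, rfl⟩
    rw [trace_corrMatB'_sub_mul hT hP]
    have htr := trace_eq_rank_of_isIdempotentElem hP
    rw [hrank, trace_fin_three, Nat.cast_one] at htr
    have h0 := diag_nonneg_of_transpose_eq_of_isIdempotentElem hT hP 0
    have h1 := diag_nonneg_of_transpose_eq_of_isIdempotentElem hT hP 1
    have h2 := diag_nonneg_of_transpose_eq_of_isIdempotentElem hT hP 2
    rcases min_cases (l ^ 2 * t₁ ^ 2) (l ^ 2 * t₂ ^ 2 + r₂ ^ 2 * (1 - l) ^ 2) with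
      ⟨he, h⟩ | ⟨he, h⟩
    · rw [he, show P 1 1 = 1 - P 0 0 - P 2 2 by linarith]
      linarith [mul_nonneg h0 (sub_nonneg.mpr h),
        mul_nonneg h2 (sub_nonneg.mpr ((h₂.trans h₁).trans h))]
    · rw [he, show P 0 0 = 1 - P 1 1 - P 2 2 by linarith]
      linarith [mul_nonneg h1 (sub_nonneg.mpr h.le),
        mul_nonneg h2 (sub_nonneg.mpr (h₂.trans h₁))]
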